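/- Suppose the pair (α,u) of an odd superfield α and an even superfield u solves the MRSKdV system, λ ∈ ℝ, and ψ is any superfield with Lψ = λψ. Then (∂ₜα)(Dψ) + (∂ₜu)ψ = M(Lψ) − L(Mψ); that is, on eigenfunctions of L the MRSKdV flow is the compatibility condition of the linear system. -/

import Mathlib

noncomputable section
open scoped BigOperators

/-- The exterior algebra `Λ` of `ℝ^N`. -/
abbrev SuperAlg (N : ℕ) : Type := ExteriorAlgebra ℝ (Fin N → ℝ)

/-- The even part `Λ₀` of the exterior algebra. -/
def LambdaEven (N : ℕ) : Submodule ℝ (SuperAlg N) :=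
  CliffordAlgebra.evenOdd (0 : QuadraticForm ℝ (Fin N → ℝ)) 0

/-- The odd part `Λ₁` of the exterior algebra. -/
def LambdaOdd (N : ℕ) : Submodule ℝ (SuperAlg N) :=
  CliffordAlgebra.evenOdd (0 : QuadraticForm ℝ (Fin N → ℝ)) 1

/-- A superfield: a pair `(f₀, f₁)` of maps `ℝ² → Λ`, encoding
`f(x,t,ϑ) = f₀(x,t) + ϑ f₁(x,t)`. -/
@[ext] structure SF (N : ℕ) where
  c0 : ℝ → ℝ → SuperAlg N
  c1 : ℝ → ℝ → SuperAlg N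

namespace SF
variable {N : ℕ}

instance : Zero (SF N) := ⟨⟨0, 0⟩⟩
instance : Add (SF N) := ⟨fun f g => ⟨f.c0 + g.c0, f.c1 + g.c1⟩⟩
instance : Neg (SF N) := ⟨fun f => ⟨-f.c0, -f.c1⟩⟩
instance : Sub (SF N) := ⟨fun f g => ⟨f.c0 - g.c0, f.c1 - g.c1⟩⟩
instance : SMul ℕ (SF N) := ⟨fun n f => ⟨n • f.c0, n • f.c1⟩⟩
instance : SMul ℤ (SF N) := ⟨fun n f => ⟨n • f.c0, n • f.c1⟩⟩
instance : SMul ℝ (SF N) := ⟨fun r f => ⟨r • f.c0, r • f.c1⟩⟩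

instance : AddCommGroup (SF N) :=
  Function.Injective.addCommGroup
    (M₂ := (ℝ → ℝ → SuperAlg N) × (ℝ → ℝ → SuperAlg N))
    (fun f => (f.c0, f.c1))
    (fun a b h => by cases a; cases b; simpa using h)
    rfl (fun _ _ => rfl) (fun _ => rfl) (fun _ _ => rfl) (fun _ _ => rfl) (fun _ _ => rfl)

instance : One (SF N) := ⟨⟨fun _ _ => 1, fun _ _ => 0⟩⟩

/-- The product of superfields: `(fg)₀ = f₀g₀`,
`(fg)₁ = f₁g₀ + σ(f₀)g₁` where `σ` is the grade involution of `Λ`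
(this is the bilinear extension of the parity-sign formula for homogeneous factors). -/
instance : Mul (SF N) := ⟨fun f g =>
  ⟨fun x t => f.c0 x t * g.c0 x t,
   fun x t => f.c1 x t * g.c0 x t + CliffordAlgebra.involute (f.c0 x t) * g.c1 x t⟩⟩

/-- An even superfield. -/
def IsEven (f : SF N) : Prop :=
  (∀ x t, f.c0 x t ∈ LambdaEven N) ∧ (∀ x t, f.c1 x t ∈ LambdaOdd N)

/-- An odd superfield. -/
def IsOdd (f : SF N) : Prop :=
  (∀ x t, f.c0 x t ∈ LambdaOdd N) ∧ (∀ x t, f.c1 x t ∈ LambdaEven N)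

/-- A superfield is invertible when `f₀(x,t)` is invertible in `Λ` for all `(x,t)`. -/
def Invertible (f : SF N) : Prop := ∀ x t, IsUnit (f.c0 x t)

/-- The multiplicative inverse of a superfield (junk unless `f` is invertible). -/
def sinv (f : SF N) : SF N :=
  ⟨fun x t => Ring.inverse (f.c0 x t),
   fun x t => -(Ring.inverse (CliffordAlgebra.involute (f.c0 x t)) * f.c1 x t *
      Ring.inverse (f.c0 x t))⟩

end SF

/-- Derivative of a `Λ`-valued function of one real variable, characterized through all
linear functionals (junk value `0` when not differentiable). -/
def derLam {N : ℕ} (g : ℝ → SuperAlg N) (x : ℝ) : SuperAlg N := by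
  classical
  exact if h : ∃ d : SuperAlg N, ∀ l : SuperAlg N →ₗ[ℝ] ℝ,
      HasDerivAt (fun y => l (g y)) (l d) x
    then h.choose else 0

/-- Smoothness of a `Λ`-valued function on `ℝ²`. -/
def SmoothLam {N : ℕ} (g : ℝ → ℝ → SuperAlg N) : Prop :=
  ∀ l : SuperAlg N →ₗ[ℝ] ℝ, ContDiff ℝ (⊤ : ℕ∞) (fun p : ℝ × ℝ => l (g p.1 p.2))

namespace SF
variable {N : ℕ}

/-- A superfield is smooth when both components are. -/
def Smooth (f : SF N) : Prop := SmoothLam f.c0 ∧ SmoothLam f.c1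

/-- `∂f`, the `x`-derivative. -/
def dx (f : SF N) : SF N :=
  ⟨fun x t => derLam (fun y => f.c0 y t) x, fun x t => derLam (fun y => f.c1 y t) x⟩

/-- `∂ₜf`, the `t`-derivative. -/
def dt (f : SF N) : SF N :=
  ⟨fun x t => derLam (fun s => f.c0 x s) t, fun x t => derLam (fun s => f.c1 x s) t⟩

/-- The odd superderivative `D`, with `Df = (f₁, ∂ₓf₀)`, so `D ∘ D = ∂`. -/
def Dsd (f : SF N) : SF N := ⟨f.c1, fun x t => derLam (fun y => f.c0 y t) x⟩

end SF

/-- `D^n`. -/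
def Dpow {N : ℕ} : ℕ → SF N → SF N
  | 0, f => f
  | m + 1, f => (Dpow m f).Dsd

/-- `∂^n`. -/
def Xpow {N : ℕ} : ℕ → SF N → SF N
  | 0, f => f
  | m + 1, f => (Xpow m f).dx

/-- `f` has the parity `(−1)^m`. -/
def parityAt {N : ℕ} (f : SF N) (m : ℕ) : Prop :=
  if m % 2 = 0 then f.IsEven else f.IsOdd

/-- The Manin–Radul supersymmetric KdV system. -/
def MRSKdV {N : ℕ} (α u : SF N) : Prop :=
  α.dt = (1/4 : ℝ) • (α.dx.dx + (3:ℝ) • (α * α.Dsd) + (6:ℝ) • (α * u)).dx ∧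
  u.dt = (1/4 : ℝ) • (u.dx.dx + (3:ℝ) • (u * u) + (3:ℝ) • (α * u.Dsd)).dx

/-- The Lax operator `L = ∂² + αD + u`. -/
def Lop {N : ℕ} (α u ψ : SF N) : SF N := ψ.dx.dx + α * ψ.Dsd + u * ψ

/-- The operator `M = (1/2)α∂D + λ∂ + (1/2)u∂ − (1/4)(∂α)D − (1/4)(∂u)`. -/
def Mop {N : ℕ} (α u : SF N) (lam : ℝ) (ψ : SF N) : SF N :=
  (1/2 : ℝ) • (α * ψ.Dsd.dx) + lam • ψ.dx + (1/2 : ℝ) • (u * ψ.dx)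
    - (1/4 : ℝ) • (α.dx * ψ.Dsd) - (1/4 : ℝ) • (u.dx * ψ)

/-- The linear system `Lψ = λψ`, `∂ₜψ = Mψ` associated with `(α,u)` at `λ`. -/
def LinSys {N : ℕ} (α u : SF N) (lam : ℝ) (ψ : SF N) : Prop :=
  Lop α u ψ = lam • ψ ∧ ψ.dt = Mop α u lam ψ

/-- `δ₀ = −(Dθ₀)θ₀⁻¹`. -/
def delta0 {N : ℕ} (θ : SF N) : SF N := -(θ.Dsd * θ.sinv)

/-- The Darboux-transformed `α̂ = −α − 2∂δ₀`. -/
def hatAlpha {N : ℕ} (α θ : SF N) : SF N := -α - (2:ℝ) • (delta0 θ).dx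

/-- The Darboux-transformed `û = u + Dα + 2δ₀(α + ∂δ₀)`. -/
def hatU {N : ℕ} (α u θ : SF N) : SF N :=
  u + α.Dsd + (2:ℝ) • (delta0 θ * (α + (delta0 θ).dx))

/-- `darbIter θ m j = θ_j[m]`, the `j`-th seed after `m` Darboux steps. -/
def darbIter {N : ℕ} (θ : ℕ → SF N) : ℕ → ℕ → SF N
  | 0, j => θ j
  | m + 1, j => (darbIter θ m j).Dsd + delta0 (darbIter θ m m) * darbIter θ m j

/-- `Titer θ n ψ = T_n ψ = (D+δ_{n−1})⋯(D+δ₀)ψ`. -/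
def Titer {N : ℕ} (θ : ℕ → SF N) : ℕ → SF N → SF N
  | 0, ψ => ψ
  | m + 1, ψ => (Titer θ m ψ).Dsd + delta0 (darbIter θ m m) * Titer θ m ψ

/-- Determinant of a matrix of superfields: Leibniz formula with rows in
ascending order (for matrices of commuting, e.g. even, entries this is the usual
determinant, and when exactly one row is odd it agrees with the Laplace
expansion along that row). -/
def detSF {N k : ℕ} (M : Matrix (Fin k) (Fin k) (SF N)) : SF N :=
  ∑ σ : Equiv.Perm (Fin k),
    ((Equiv.Perm.sign σ : ℤ)) • (((List.finRange k).map fun i => M i (σ i)).prod)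

/-- Entrywise `D`-derivative of a matrix of superfields. -/
def DmatSF {N m n : ℕ} (M : Matrix (Fin m) (Fin n) (SF N)) : Matrix (Fin m) (Fin n) (SF N) :=
  Matrix.of fun i j => (M i j).Dsd

/-- The embedding `Fin (k−1) → Fin k` skipping `j`. -/
def dropIdx {k : ℕ} (j : Fin k) (i : Fin (k - 1)) : Fin k :=
  ⟨if i.1 < j.1 then i.1 else i.1 + 1, by
    have h1 := i.2; have h2 := j.2; split <;> omega⟩

/-- The minor of `M` obtained by deleting row `j` and column `i`. -/
def minorSF {N k : ℕ} (M : Matrix (Fin k) (Fin k) (SF N)) (j i : Fin k) :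
    Matrix (Fin (k-1)) (Fin (k-1)) (SF N) :=
  M.submatrix (dropIdx j) (dropIdx i)

/-- Adjugate matrix (matrix of cofactors, transposed). -/
def adjSF {N k : ℕ} (M : Matrix (Fin k) (Fin k) (SF N)) : Matrix (Fin k) (Fin k) (SF N) :=
  Matrix.of fun i j => ((-1 : ℤ) ^ (i.1 + j.1)) • detSF (minorSF M j i)

/-- Inverse of a matrix of (even) superfields, via the adjugate
(junk unless `detSF M` is invertible). -/
def invSF {N k : ℕ} (M : Matrix (Fin k) (Fin k) (SF N)) : Matrix (Fin k) (Fin k) (SF N) :=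
  Matrix.of fun i j => (detSF M).sinv * adjSF M i j

section EvenWronskian

variable {N : ℕ}

/-- `θ^{(0)} = (θ₀, θ₂, …)`. -/
def evenSeq (θ : ℕ → SF N) : ℕ → SF N := fun j => θ (2 * j)

/-- `θ^{(1)} = (θ₁, θ₃, …)`. -/
def oddSeq (θ : ℕ → SF N) : ℕ → SF N := fun j => θ (2 * j + 1)

/-- The `k×k` Wronski matrix with rows `v, ∂v, …, ∂^{k−1}v`. -/
def Wmat (N : ℕ) (k : ℕ) (v : ℕ → SF N) : Matrix (Fin k) (Fin k) (SF N) :=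
  Matrix.of fun i j => Xpow i.1 (v j.1)

/-- The Wronski matrix with last row replaced by `∂^k v`. -/
def WmatHat (N : ℕ) (k : ℕ) (v : ℕ → SF N) : Matrix (Fin k) (Fin k) (SF N) :=
  Matrix.of fun i j => if i.1 = k - 1 then Xpow k (v j.1) else Xpow i.1 (v j.1)

/-- The Wronski matrix with rows `Dv, D∂v, …, D∂^{k−2}v` and last row `∂^k v`. -/
def WmatBarD (N : ℕ) (k : ℕ) (v : ℕ → SF N) : Matrix (Fin k) (Fin k) (SF N) :=
  Matrix.of fun i j => if i.1 = k - 1 then Xpow k (v j.1) else (Xpow i.1 (v j.1)).Dsd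

/-- `W^{(0)}` (even case, `n = 2k`). -/
def W0E (N k : ℕ) (θ : ℕ → SF N) : Matrix (Fin k) (Fin k) (SF N) := Wmat N k (evenSeq θ)

/-- `W^{(1)}` (even case, `n = 2k`). -/
def W1E (N k : ℕ) (θ : ℕ → SF N) : Matrix (Fin k) (Fin k) (SF N) := Wmat N k (oddSeq θ)

/-- The Schur complement `W^{(0)} − W^{(1)}(DW^{(1)})⁻¹DW^{(0)}`. -/
def SchurE (N k : ℕ) (θ : ℕ → SF N) : Matrix (Fin k) (Fin k) (SF N) :=
  W0E N k θ - W1E N k θ * invSF (DmatSF (W1E N k θ)) * DmatSF (W0E N k θ)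

/-- The Schur complement `DW^{(1)} − (DW^{(0)})(W^{(0)})⁻¹W^{(1)}`. -/
def SchurE2 (N k : ℕ) (θ : ℕ → SF N) : Matrix (Fin k) (Fin k) (SF N) :=
  DmatSF (W1E N k θ) - DmatSF (W0E N k θ) * invSF (W0E N k θ) * W1E N k θ

/-- `sdet 𝒲` (even case). -/
def sdetE (N k : ℕ) (θ : ℕ → SF N) : SF N :=
  detSF (SchurE N k θ) * (detSF (DmatSF (W1E N k θ))).sinv

/-- The Schur complement of the block matrix `𝒲̂` (even case). -/
def SchurEHat (N k : ℕ) (θ : ℕ → SF N) : Matrix (Fin k) (Fin k) (SF N) :=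
  WmatHat N k (evenSeq θ) - WmatHat N k (oddSeq θ) * invSF (DmatSF (W1E N k θ)) * DmatSF (W0E N k θ)

/-- `sdet 𝒲̂` (even case). -/
def sdetEHat (N k : ℕ) (θ : ℕ → SF N) : SF N :=
  detSF (SchurEHat N k θ) * (detSF (DmatSF (W1E N k θ))).sinv

end EvenWronskian

section OddWronskian

/-- `W^{(0)}`, a `(k+1)×(k+1)` matrix (odd case, `n = 2k+1`). -/
def W0O (N k : ℕ) (θ : ℕ → SF N) : Matrix (Fin (k+1)) (Fin (k+1)) (SF N) :=
  Matrix.of fun i j => Xpow i.1 (θ (2 * j.1))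

/-- `W^{(1)}`, a `(k+1)×k` matrix (odd case). -/
def W1O (N k : ℕ) (θ : ℕ → SF N) : Matrix (Fin (k+1)) (Fin k) (SF N) :=
  Matrix.of fun i j => Xpow i.1 (θ (2 * j.1 + 1))

/-- `W̃^{(0)}`: `W^{(0)}` with its last row removed. -/
def Wtil0 (N k : ℕ) (θ : ℕ → SF N) : Matrix (Fin k) (Fin (k+1)) (SF N) :=
  Matrix.of fun i j => Xpow i.1 (θ (2 * j.1))

/-- `W̃^{(1)}`: `W^{(1)}` with its last row removed. -/
def Wtil1 (N k : ℕ) (θ : ℕ → SF N) : Matrix (Fin k) (Fin k) (SF N) :=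
  Matrix.of fun i j => Xpow i.1 (θ (2 * j.1 + 1))

/-- `W̌^{(0)}`: `W^{(0)}` with its second-to-last row removed. -/
def Wchk0 (N k : ℕ) (θ : ℕ → SF N) : Matrix (Fin k) (Fin (k+1)) (SF N) :=
  Matrix.of fun i j => Xpow (if i.1 = k - 1 then k else i.1) (θ (2 * j.1))

/-- `W̌^{(1)}`: `W^{(1)}` with its second-to-last row removed. -/
def Wchk1 (N k : ℕ) (θ : ℕ → SF N) : Matrix (Fin k) (Fin k) (SF N) :=
  Matrix.of fun i j => Xpow (if i.1 = k - 1 then k else i.1) (θ (2 * j.1 + 1))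

/-- `Ŵ^{(0)}`: `W^{(0)}` with last row `∂^k θ^{(0)}` replaced by `D∂^k θ^{(0)}`. -/
def W0OHat (N k : ℕ) (θ : ℕ → SF N) : Matrix (Fin (k+1)) (Fin (k+1)) (SF N) :=
  Matrix.of fun i j => if i.1 = k then Dpow (2*k+1) (θ (2 * j.1)) else Xpow i.1 (θ (2 * j.1))

/-- `Ŵ^{(1)}`: `W^{(1)}` with last row `∂^k θ^{(1)}` replaced by `D∂^k θ^{(1)}`. -/
def W1OHat (N k : ℕ) (θ : ℕ → SF N) : Matrix (Fin (k+1)) (Fin k) (SF N) :=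
  Matrix.of fun i j => if i.1 = k then Dpow (2*k+1) (θ (2 * j.1 + 1)) else Xpow i.1 (θ (2 * j.1 + 1))

/-- The Schur complement `W^{(0)} − W^{(1)}(DW̃^{(1)})⁻¹DW̃^{(0)}`. -/
def SchurO (N k : ℕ) (θ : ℕ → SF N) : Matrix (Fin (k+1)) (Fin (k+1)) (SF N) :=
  W0O N k θ - W1O N k θ * invSF (DmatSF (Wtil1 N k θ)) * DmatSF (Wtil0 N k θ)

/-- The Schur complement `W^{(0)} − W^{(1)}(DW̌^{(1)})⁻¹DW̌^{(0)}`. -/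
def SchurOchk (N k : ℕ) (θ : ℕ → SF N) : Matrix (Fin (k+1)) (Fin (k+1)) (SF N) :=
  W0O N k θ - W1O N k θ * invSF (DmatSF (Wchk1 N k θ)) * DmatSF (Wchk0 N k θ)

/-- The Schur complement `Ŵ^{(0)} − Ŵ^{(1)}(DW̃^{(1)})⁻¹DW̃^{(0)}`. -/
def SchurOHat (N k : ℕ) (θ : ℕ → SF N) : Matrix (Fin (k+1)) (Fin (k+1)) (SF N) :=
  W0OHat N k θ - W1OHat N k θ * invSF (DmatSF (Wtil1 N k θ)) * DmatSF (Wtil0 N k θ)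

/-- `sdet 𝒲` (odd case). -/
def sdetO (N k : ℕ) (θ : ℕ → SF N) : SF N :=
  detSF (SchurO N k θ) * (detSF (DmatSF (Wtil1 N k θ))).sinv

/-- `sdet 𝒲̌` (odd case). -/
def sdetOchk (N k : ℕ) (θ : ℕ → SF N) : SF N :=
  detSF (SchurOchk N k θ) * (detSF (DmatSF (Wchk1 N k θ))).sinv

/-- The quotient `det(Ŵ^{(0)} − Ŵ^{(1)}(DW̃^{(1)})⁻¹DW̃^{(0)}) / det(W^{(0)} − W^{(1)}(DW̃^{(1)})⁻¹DW̃^{(0)})`. -/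
def Qodd (N k : ℕ) (θ : ℕ → SF N) : SF N :=
  detSF (SchurOHat N k θ) * (detSF (SchurO N k θ)).sinv

end OddWronskian

set_option linter.unusedSimpArgs false

theorem absThm {A : Type*} [Ring A] [Algebra ℝ A] (D : A →ₗ[ℝ] A) (σ : A →ₐ[ℝ] A)
    (hD : ∀ a b, D (a*b) = D a * b + σ a * D b)
    (hσD : ∀ a, σ (D a) = - D (σ a))
    (he : ∀ a, σ a = a → ∀ b, b * a = a * b)
    (ho : ∀ a, σ a = -a → ∀ b, b * a = a * σ b)
    (α u ψ : A) (lam : ℝ) (hα : σ α = -α) (hu : σ u = u)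
    (hL : D (D (D (D ψ))) + α * D ψ + u * ψ = lam • ψ) :
    ((1/4 : ℝ) • D (D (D (D (D (D α))) + (3:ℝ) • (α * D α) + (6:ℝ) • (α * u)))) * D ψ
    + ((1/4 : ℝ) • D (D (D (D (D (D u))) + (3:ℝ) • (u * u) + (3:ℝ) • (α * D u)))) * ψ
    = ((1/2 : ℝ) • (α * D (D (D (D (D (D (D ψ))) + α * D ψ + u * ψ))))
        + lam • D (D (D (D (D (D ψ))) + α * D ψ + u * ψ))
        + (1/2 : ℝ) • (u * D (D (D (D (D (D ψ))) + α * D ψ + u * ψ)))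
        - (1/4 : ℝ) • (D (D α) * D (D (D (D (D ψ))) + α * D ψ + u * ψ))
        - (1/4 : ℝ) • (D (D u) * (D (D (D (D ψ))) + α * D ψ + u * ψ)))
      - (D (D (D (D ((1/2 : ℝ) • (α * D (D (D ψ))) + lam • D (D ψ)
            + (1/2 : ℝ) • (u * D (D ψ)) - (1/4 : ℝ) • (D (D α) * D ψ)
            - (1/4 : ℝ) • (D (D u) * ψ)))))
        + α * D ((1/2 : ℝ) • (α * D (D (D ψ))) + lam • D (D ψ)
            + (1/2 : ℝ) • (u * D (D ψ)) - (1/4 : ℝ) • (D (D α) * D ψ)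
            - (1/4 : ℝ) • (D (D u) * ψ))
        + u * ((1/2 : ℝ) • (α * D (D (D ψ))) + lam • D (D ψ)
            + (1/2 : ℝ) • (u * D (D ψ)) - (1/4 : ℝ) • (D (D α) * D ψ)
            - (1/4 : ℝ) • (D (D u) * ψ))) := by
  have s1 : σ (D α) = D α := by rw [hσD, hα]; simp
  have s2 : σ (D (D α)) = -D (D α) := by rw [hσD, s1]
  have s3 : σ (D (D (D α))) = D (D (D α)) := by rw [hσD, s2]; simp
  have s4 : σ (D (D (D (D α)))) = -D (D (D (D α))) := by rw [hσD, s3]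
  have s5 : σ (D (D (D (D (D α))))) = D (D (D (D (D α)))) := by rw [hσD, s4]; simp
  have v1 : σ (D u) = -D u := by rw [hσD, hu]
  have v2 : σ (D (D u)) = D (D u) := by rw [hσD, v1]; simp
  have v3 : σ (D (D (D u))) = -D (D (D u)) := by rw [hσD, v2]
  have v4 : σ (D (D (D (D u)))) = D (D (D (D u))) := by rw [hσD, v3]; simp
  have v5 : σ (D (D (D (D (D u))))) = -D (D (D (D (D u)))) := by rw [hσD, v4]
  have e1 : ∀ a, σ a = a → ∀ b x, b * (a * x) = a * (b * x) := by
    intro a h b x; rw [← mul_assoc, he a h, mul_assoc]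
  have o1 : ∀ a, σ a = -a → ∀ b, σ b = -b → b * a = -(a * b) := by
    intro a h b h'; rw [ho a h, h']; simp
  have o2 : ∀ a, σ a = -a → ∀ b, σ b = -b → ∀ x, b * (a * x) = -(a * (b * x)) := by
    intro a h b h' x; rw [← mul_assoc, o1 a h b h', neg_mul, mul_assoc]
  have q1 : ∀ a, σ a = -a → a * a = 0 := by
    intro a h
    have h2 := o1 a h a h
    have h3 : (2:ℝ) • (a * a) = 0 := by
      rw [two_smul]; nth_rewrite 1 [h2]; simp
    simpa using h3
  have q2 : ∀ a, σ a = -a → ∀ x, a * (a * x) = 0 := by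
    intro a h x; rw [← mul_assoc, q1 a h, zero_mul]
  have key : lam • (D (D α) * D ψ + D (D u) * ψ)
      = D (D α) * D (D (D (D (D ψ))) + α * D ψ + u * ψ)
        + D (D u) * (D (D (D (D ψ))) + α * D ψ + u * ψ) := by
    rw [hL]; simp
  have lamp : lam • D (D (D (D (D (D ψ))) + α * D ψ + u * ψ))
      = lam • (D (D (D (D (D (D ψ))))) + α * D (D (D ψ)) + u * D (D ψ))
        + (D (D α) * D (D (D (D (D ψ))) + α * D ψ + u * ψ)
        + D (D u) * (D (D (D (D ψ))) + α * D ψ + u * ψ)) := by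
    rw [← key, ← smul_add]
    congr 1
    simp only [map_add, map_neg, hD, hα, hu, s1, v1, neg_mul, mul_add, neg_neg]
    abel
  rw [lamp]
  simp only [map_add, map_sub, map_neg, map_smul, hD, hα, hu, s1, s2, s3, s4, s5, v1, v2, v3, v4, v5,
    neg_mul, mul_neg, mul_add, add_mul, mul_sub, sub_mul, neg_neg, mul_assoc, smul_mul_assoc,
    mul_smul_comm, smul_add, smul_sub, smul_neg,
    q2 _ hα, q1 _ hα, q2 _ v1, q1 _ v1, q2 _ s2, q1 _ s2]
  -- odd elements
  simp only [o1 _ hα _ s2, o2 _ hα _ s2, o1 _ hα _ v1, o2 _ hα _ v1, o1 _ hα _ v3, o2 _ hα _ v3,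
    o1 _ s2 _ v1, o2 _ s2 _ v1, o1 _ hα _ s4, o2 _ hα _ s4,
    he _ s1 α, e1 _ s1 α, he _ s1 (D (D α)), e1 _ s1 (D (D α)),
    e1 _ s3 α, e1 _ s3 (D (D α)), he _ s3 α,
    he _ hu α, he _ hu (D α), he _ hu (D (D α)), he _ hu (D u), he _ hu (D (D u)),
    e1 _ hu α, e1 _ hu (D α), e1 _ hu (D (D α)), e1 _ hu (D u), e1 _ hu (D (D u)),
    e1 _ v2 α, e1 _ v2 (D α), e1 _ v2 (D (D α)), e1 _ v2 (D u), he _ v2 α,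
    e1 _ s1 (D u), he _ s1 (D u), e1 _ v2 (D (D (D α))), e1 _ hu (D (D (D α))),
    e1 _ hu (D (D (D u))), e1 _ hu (D (D (D (D α)))),  e1 _ hu (D (D (D (D u)))),
    q2 _ hα, q1 _ hα, q2 _ v1, q1 _ v1, q2 _ s2, q1 _ s2, mul_neg, smul_neg, neg_neg, mul_zero, smul_zero]
  module

instance finExt (N : ℕ) : Module.Finite ℝ (SuperAlg N) := by
  have h1 : (⨆ n : ℕ, (⋀[ℝ]^n (Fin N → ℝ))) = ⊤ :=
    (DirectSum.Decomposition.isInternal (fun n : ℕ => ⋀[ℝ]^n (Fin N → ℝ))).submodule_iSup_eq_top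
  have h0 : ∀ n, N < n → (⋀[ℝ]^n (Fin N → ℝ)) = ⊥ := by
    intro n hn
    have := exteriorPower.finrank_eq (R := ℝ) (M := Fin N → ℝ) (n := n)
    rw [Module.finrank_fin_fun, Nat.choose_eq_zero_of_lt hn] at this
    exact Submodule.finrank_eq_zero.mp this
  have h2 : (⨆ n ∈ Finset.range (N+1), (⋀[ℝ]^n (Fin N → ℝ))) = ⊤ := by
    rw [eq_top_iff, ← h1]
    refine iSup_le fun n => ?_
    by_cases hn : N < n
    · rw [h0 n hn]; exact bot_le
    · exact le_iSup₂_of_le n (by simp; omega) le_rfl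
  rw [Module.finite_def, ← h2]
  refine Submodule.fg_biSup _ _ fun n _ => ?_
  exact Module.Finite.iff_fg.mp inferInstance

section ext
variable {N : ℕ}

theorem iota_mul (v : Fin N → ℝ) (x : SuperAlg N) :
    ExteriorAlgebra.ι ℝ v * x = CliffordAlgebra.involute x * ExteriorAlgebra.ι ℝ v := by
  induction x using ExteriorAlgebra.induction with
  | algebraMap r => rw [AlgHom.commutes]; exact (Algebra.commutes r _).symm
  | ι w =>
    have h : CliffordAlgebra.involute (ExteriorAlgebra.ι ℝ w : SuperAlg N)
        = -ExteriorAlgebra.ι ℝ w := CliffordAlgebra.involute_ι _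
    rw [h, neg_mul, eq_neg_iff_add_eq_zero]
    exact ExteriorAlgebra.ι_add_mul_swap v w
  | mul a b ha hb => rw [← mul_assoc, ha, mul_assoc, hb, ← mul_assoc, map_mul]
  | add a b ha hb => rw [mul_add, ha, hb, map_add, add_mul]

theorem even_comm {a : SuperAlg N} (h : CliffordAlgebra.involute a = a) (b : SuperAlg N) :
    b * a = a * b := by
  induction b using ExteriorAlgebra.induction with
  | algebraMap r => exact Algebra.commutes r _
  | ι w => rw [iota_mul, h]
  | mul x y hx hy => rw [mul_assoc, hy, ← mul_assoc, hx, mul_assoc]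
  | add x y hx hy => rw [add_mul, hx, hy, mul_add]

theorem odd_comm {a : SuperAlg N} (h : CliffordAlgebra.involute a = -a) (b : SuperAlg N) :
    b * a = a * CliffordAlgebra.involute b := by
  induction b using ExteriorAlgebra.induction with
  | algebraMap r => rw [AlgHom.commutes]; exact Algebra.commutes r _
  | ι w =>
    have h' : CliffordAlgebra.involute (ExteriorAlgebra.ι ℝ w : SuperAlg N)
        = -ExteriorAlgebra.ι ℝ w := CliffordAlgebra.involute_ι _
    rw [iota_mul, h, h']; simp
  | mul x y hx hy => rw [mul_assoc, hy, ← mul_assoc, hx, mul_assoc, map_mul]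
  | add x y hx hy => rw [add_mul, hx, hy, map_add, mul_add]
end ext

section der
variable {N : ℕ}

def HD (g : ℝ → SuperAlg N) (d : SuperAlg N) (x : ℝ) : Prop :=
  ∀ l : SuperAlg N →ₗ[ℝ] ℝ, HasDerivAt (fun y => l (g y)) (l d) x

theorem dual_ext {a b : SuperAlg N} (h : ∀ l : SuperAlg N →ₗ[ℝ] ℝ, l a = l b) : a = b := by
  have B := Module.finBasis ℝ (SuperAlg N)
  exact B.ext_elem fun i => h (B.coord i)

theorem HD.eq {g : ℝ → SuperAlg N} {d : SuperAlg N} {x : ℝ} (h : HD g d x) : derLam g x = d := by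
  have hex : ∃ d : SuperAlg N, ∀ l : SuperAlg N →ₗ[ℝ] ℝ,
      HasDerivAt (fun y => l (g y)) (l d) x := ⟨d, h⟩
  unfold derLam
  rw [dif_pos hex]
  exact dual_ext fun l => (hex.choose_spec l).unique (h l)

theorem HD_of_diff {g : ℝ → SuperAlg N} {x : ℝ}
    (h : ∀ l : SuperAlg N →ₗ[ℝ] ℝ, DifferentiableAt ℝ (fun y => l (g y)) x) :
    HD g (derLam g x) x := by
  have B := Module.finBasis ℝ (SuperAlg N)
  have key : HD g (∑ i, deriv (fun y => B.coord i (g y)) x • B i) x := by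
    intro l
    have e : (fun y => l (g y)) = fun y => ∑ i, B.coord i (g y) * l (B i) := by
      funext y
      conv_lhs => rw [← B.sum_repr (g y)]
      simp only [map_sum, map_smul, smul_eq_mul, Module.Basis.coord_apply]
    rw [e, map_sum]
    simp only [map_smul, smul_eq_mul]
    exact HasDerivAt.fun_sum fun i _ => ((h (B.coord i)).hasDerivAt).mul_const _
  rwa [key.eq]

theorem mul_expand (l : SuperAlg N →ₗ[ℝ] ℝ) {ι : Type*} [Fintype ι]
    (B : Module.Basis ι ℝ (SuperAlg N)) (a b : SuperAlg N) :
    l (a * b) = ∑ i, B.coord i a * (l ∘ₗ LinearMap.mulLeft ℝ (B i)) b := by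
  conv_lhs => rw [← B.sum_repr a]
  simp only [Finset.sum_mul, map_sum, map_smul, smul_mul_assoc, smul_eq_mul,
    Module.Basis.coord_apply, LinearMap.comp_apply, LinearMap.mulLeft_apply]

theorem HD.mul {f g : ℝ → SuperAlg N} {c d : SuperAlg N} {x : ℝ} (hf : HD f c x) (hg : HD g d x) :
    HD (fun y => f y * g y) (c * g x + f x * d) x := by
  have B := Module.finBasis ℝ (SuperAlg N)
  intro l
  simp only [map_add, mul_expand l B, ← Finset.sum_add_distrib]
  exact HasDerivAt.fun_sum fun i _ => (hf (B.coord i)).mul (hg _)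

theorem HD.add {f g : ℝ → SuperAlg N} {c d : SuperAlg N} {x : ℝ} (hf : HD f c x) (hg : HD g d x) :
    HD (fun y => f y + g y) (c + d) x := by
  intro l; simp only [map_add]; exact (hf l).add (hg l)

theorem HD.map {f : ℝ → SuperAlg N} {c : SuperAlg N} {x : ℝ} (hf : HD f c x)
    (T : SuperAlg N →ₗ[ℝ] SuperAlg N) : HD (fun y => T (f y)) (T c) x :=
  fun l => hf (l ∘ₗ T)

theorem SmoothLam.hd {f : ℝ → ℝ → SuperAlg N} (hf : SmoothLam f) (x t : ℝ) :
    HD (fun y => f y t) (derLam (fun y => f y t) x) x := by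
  refine HD_of_diff fun l => ?_
  have h1 : Differentiable ℝ (fun p : ℝ × ℝ => l (f p.1 p.2)) := (hf l).differentiable (by simp)
  exact (h1.comp (f := fun y : ℝ => (y, t)) (by fun_prop)) x

theorem SmoothLam.mul {f g : ℝ → ℝ → SuperAlg N} (hf : SmoothLam f) (hg : SmoothLam g) :
    SmoothLam (fun x t => f x t * g x t) := by
  have B := Module.finBasis ℝ (SuperAlg N)
  intro l
  simp only [mul_expand l B]
  exact ContDiff.sum fun i _ => (hf (B.coord i)).mul (hg _)

theorem SmoothLam.add {f g : ℝ → ℝ → SuperAlg N} (hf : SmoothLam f) (hg : SmoothLam g) :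
    SmoothLam (fun x t => f x t + g x t) := by
  intro l; simp only [map_add]; exact (hf l).add (hg l)

theorem SmoothLam.map {f : ℝ → ℝ → SuperAlg N} (hf : SmoothLam f)
    (T : SuperAlg N →ₗ[ℝ] SuperAlg N) : SmoothLam (fun x t => T (f x t)) :=
  fun l => hf (l ∘ₗ T)

theorem SmoothLam.const (a : SuperAlg N) : SmoothLam (fun _ _ => a) :=
  fun _ => contDiff_const

theorem SmoothLam.der {f : ℝ → ℝ → SuperAlg N} (hf : SmoothLam f) :
    SmoothLam (fun x t => derLam (fun y => f y t) x) := by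
  intro l
  have e : (fun p : ℝ × ℝ => l (derLam (fun y => f y p.2) p.1))
      = fun p : ℝ × ℝ => fderiv ℝ (fun p : ℝ × ℝ => l (f p.1 p.2)) p (1, 0) := by
    funext p
    have h1 : DifferentiableAt ℝ (fun p : ℝ × ℝ => l (f p.1 p.2)) p :=
      (hf l).differentiable (by simp) p
    have h2 : HasDerivAt (fun y : ℝ => (y, p.2)) ((1:ℝ), (0:ℝ)) p.1 :=
      (hasDerivAt_id p.1).prodMk (hasDerivAt_const _ _)
    have h3 := HasFDerivAt.comp_hasDerivAt (f := fun y : ℝ => (y, p.2)) p.1 (h1.hasFDerivAt) h2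
    exact (hf.hd p.1 p.2 l).unique h3
  rw [e]
  exact ((hf l).fderiv_right (m := (⊤ : ℕ∞)) (by simp)).clm_apply contDiff_const
end der

section ringSF
variable {N : ℕ}

theorem SF.ext' {f g : SF N} (h0 : ∀ x t, f.c0 x t = g.c0 x t) (h1 : ∀ x t, f.c1 x t = g.c1 x t) :
    f = g := SF.ext (funext fun x => funext (h0 x)) (funext fun x => funext (h1 x))

@[simp] theorem SF.add_c0 (f g : SF N) (x t) : (f + g).c0 x t = f.c0 x t + g.c0 x t := rfl
@[simp] theorem SF.add_c1 (f g : SF N) (x t) : (f + g).c1 x t = f.c1 x t + g.c1 x t := rfl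
@[simp] theorem SF.neg_c0 (f : SF N) (x t) : (-f).c0 x t = -f.c0 x t := rfl
@[simp] theorem SF.neg_c1 (f : SF N) (x t) : (-f).c1 x t = -f.c1 x t := rfl
@[simp] theorem SF.zero_c0 (x t) : (0 : SF N).c0 x t = 0 := rfl
@[simp] theorem SF.zero_c1 (x t) : (0 : SF N).c1 x t = 0 := rfl
@[simp] theorem SF.one_c0 (x t) : (1 : SF N).c0 x t = 1 := rfl
@[simp] theorem SF.one_c1 (x t) : (1 : SF N).c1 x t = 0 := rfl
@[simp] theorem SF.smul_c0 (r : ℝ) (f : SF N) (x t) : (r • f).c0 x t = r • f.c0 x t := rfl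
@[simp] theorem SF.smul_c1 (r : ℝ) (f : SF N) (x t) : (r • f).c1 x t = r • f.c1 x t := rfl
@[simp] theorem SF.mul_c0 (f g : SF N) (x t) : (f * g).c0 x t = f.c0 x t * g.c0 x t := rfl
@[simp] theorem SF.mul_c1 (f g : SF N) (x t) : (f * g).c1 x t =
  f.c1 x t * g.c0 x t + CliffordAlgebra.involute (f.c0 x t) * g.c1 x t := rfl

instance instRingSF : Ring (SF N) :=
  { (inferInstance : AddCommGroup (SF N)), (inferInstance : Mul (SF N)),
    (inferInstance : One (SF N)) with
    left_distrib := fun a b c => by apply SF.ext' <;> intros <;> simp [mul_add]; abel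
    right_distrib := fun a b c => by apply SF.ext' <;> intros <;> simp [add_mul]; abel
    zero_mul := fun a => by apply SF.ext' <;> intros <;> simp
    mul_zero := fun a => by apply SF.ext' <;> intros <;> simp
    mul_assoc := fun a b c => by
      apply SF.ext' <;> intros <;> simp [mul_assoc, mul_add, add_mul, add_assoc]
    one_mul := fun a => by apply SF.ext' <;> intros <;> simp
    mul_one := fun a => by apply SF.ext' <;> intros <;> simp }

instance instModuleSF : Module ℝ (SF N) where
  one_smul a := by apply SF.ext' <;> intros <;> simp
  mul_smul r s a := by apply SF.ext' <;> intros <;> simp [mul_smul]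
  smul_zero r := by apply SF.ext' <;> intros <;> simp
  smul_add r a b := by apply SF.ext' <;> intros <;> simp
  add_smul r s a := by apply SF.ext' <;> intros <;> simp [add_smul]
  zero_smul a := by apply SF.ext' <;> intros <;> simp

instance instAlgebraSF : Algebra ℝ (SF N) :=
  Algebra.ofModule
    (fun r a b => by apply SF.ext' <;> intros <;> simp)
    (fun r a b => by apply SF.ext' <;> intros <;> simp)

def smoothSub (N : ℕ) : Subalgebra ℝ (SF N) where
  carrier := {f | f.Smooth}
  mul_mem' := fun {a b} ha hb => ⟨ha.1.mul hb.1,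
    (ha.2.mul hb.1).add ((ha.1.map CliffordAlgebra.involute.toLinearMap).mul hb.2)⟩
  add_mem' := fun {a b} ha hb => ⟨ha.1.add hb.1, ha.2.add hb.2⟩
  algebraMap_mem' := fun r => by
    rw [Algebra.algebraMap_eq_smul_one]
    exact ⟨SmoothLam.const (r • 1), SmoothLam.const (r • 0)⟩

def Dlin (N : ℕ) : smoothSub N →ₗ[ℝ] smoothSub N where
  toFun f := ⟨f.1.Dsd, f.2.2, f.2.1.der⟩
  map_add' f g := by
    apply Subtype.ext
    apply SF.ext' <;> intro x t
    · rfl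
    · exact ((f.2.1.hd x t).add (g.2.1.hd x t)).eq
  map_smul' r f := by
    apply Subtype.ext
    apply SF.ext' <;> intro x t
    · rfl
    · exact ((f.2.1.hd x t).map (r • LinearMap.id)).eq

def sgSF (f : SF N) : SF N :=
  ⟨fun x t => CliffordAlgebra.involute (f.c0 x t), fun x t => -CliffordAlgebra.involute (f.c1 x t)⟩

def sgAlg (N : ℕ) : smoothSub N →ₐ[ℝ] smoothSub N :=
  AlgHom.ofLinearMap
    { toFun := fun f => ⟨sgSF f.1, f.2.1.map CliffordAlgebra.involute.toLinearMap,
        f.2.2.map (-CliffordAlgebra.involute.toLinearMap)⟩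
      map_add' := fun f g => by
        apply Subtype.ext
        apply SF.ext' <;> intro x t <;> simp [sgSF]; abel
      map_smul' := fun r f => by
        apply Subtype.ext
        apply SF.ext' <;> intro x t <;> simp [sgSF] }
    (by apply Subtype.ext; apply SF.ext' <;> intro x t <;> simp [sgSF])
    (fun f g => by
      apply Subtype.ext
      apply SF.ext' <;> intro x t <;> simp [sgSF]; abel)

theorem sg_c0 (f : smoothSub N) (x t) :
    (sgAlg N f).1.c0 x t = CliffordAlgebra.involute (f.1.c0 x t) := rfl
theorem sg_c1 (f : smoothSub N) (x t) :
    (sgAlg N f).1.c1 x t = -CliffordAlgebra.involute (f.1.c1 x t) := rfl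

theorem Dlin_mul (a b : smoothSub N) :
    Dlin N (a * b) = Dlin N a * b + sgAlg N a * Dlin N b := by
  apply Subtype.ext
  apply SF.ext' <;> intro x t
  · rfl
  · refine ((a.2.1.hd x t).mul (b.2.1.hd x t)).eq.trans ?_
    simp [sg_c0, sg_c1, Dlin, SF.Dsd]

theorem sg_Dlin (a : smoothSub N) : sgAlg N (Dlin N a) = - Dlin N (sgAlg N a) := by
  apply Subtype.ext
  apply SF.ext' <;> intro x t
  · simp [sg_c0, sg_c1, Dlin, SF.Dsd]
  · have := ((a.2.1.hd x t).map CliffordAlgebra.involute.toLinearMap).eq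
    simp only [AlgHom.toLinearMap_apply] at this
    simp [sg_c0, sg_c1, Dlin, SF.Dsd, this]

theorem sg_even (a : smoothSub N) (h : sgAlg N a = a) (b : smoothSub N) : b * a = a * b := by
  have h0 : ∀ x t, CliffordAlgebra.involute (a.1.c0 x t) = a.1.c0 x t := fun x t => by
    rw [← sg_c0, h]
  have h1 : ∀ x t, CliffordAlgebra.involute (a.1.c1 x t) = -a.1.c1 x t := fun x t => by
    rw [eq_neg_iff_add_eq_zero, ← neg_eq_iff_add_eq_zero, ← sg_c1, h]
  apply Subtype.ext
  apply SF.ext' <;> intro x t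
  · simp [even_comm (h0 x t)]
  · simp [even_comm (h0 x t), odd_comm (h1 x t), h0, add_comm]

theorem sg_odd (a : smoothSub N) (h : sgAlg N a = -a) (b : smoothSub N) :
    b * a = a * sgAlg N b := by
  have h0 : ∀ x t, CliffordAlgebra.involute (a.1.c0 x t) = -a.1.c0 x t := fun x t => by
    rw [← sg_c0, h]; rfl
  have h1 : ∀ x t, CliffordAlgebra.involute (a.1.c1 x t) = a.1.c1 x t := fun x t => by
    have : -CliffordAlgebra.involute (a.1.c1 x t) = -a.1.c1 x t := by rw [← sg_c1, h]; rfl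
    exact neg_injective this
  apply Subtype.ext
  apply SF.ext' <;> intro x t
  · simp [odd_comm (h0 x t), sg_c0]
  · simp [even_comm (h1 x t), odd_comm (h0 x t), h0, sg_c0, sg_c1, add_comm]
end ringSF

/-- on eigenfunctions of `L`, the MRSKdV flow is the compatibility
condition of the linear system: `(∂ₜα)(Dψ) + (∂ₜu)ψ = M(Lψ) − L(Mψ)`. -/
theorem statement_0 {N : ℕ} (hN : 1 ≤ N) (α u : SF N)
    (hαo : α.IsOdd) (hue : u.IsEven) (hαs : α.Smooth) (hus : u.Smooth)
    (hMR : MRSKdV α u) (lam : ℝ) (ψ : SF N) (hψs : ψ.Smooth)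
    (hL : Lop α u ψ = lam • ψ) :
    α.dt * ψ.Dsd + u.dt * ψ = Mop α u lam (Lop α u ψ) - Lop α u (Mop α u lam ψ) := by
  let A : smoothSub N := ⟨α, hαs⟩
  let U : smoothSub N := ⟨u, hus⟩
  let P : smoothSub N := ⟨ψ, hψs⟩
  have hA : sgAlg N A = -A := by
    apply Subtype.ext
    apply SF.ext' <;> intro x t
    · exact CliffordAlgebra.involute_eq_of_mem_odd (hαo.1 x t)
    · exact congrArg _ (CliffordAlgebra.involute_eq_of_mem_even (hαo.2 x t))
  have hU : sgAlg N U = U := by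
    apply Subtype.ext
    apply SF.ext' <;> intro x t
    · exact CliffordAlgebra.involute_eq_of_mem_even (hue.1 x t)
    · rw [sg_c1]
      exact (congrArg _ (CliffordAlgebra.involute_eq_of_mem_odd (hue.2 x t))).trans (neg_neg _)
  have key := absThm (Dlin N) (sgAlg N) Dlin_mul sg_Dlin sg_even sg_odd A U P lam hA hU
    (Subtype.ext hL)
  rw [hMR.1, hMR.2]
  exact congrArg Subtype.val key
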